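/- arXiv:1604.07710 — 2 statements merged into one kernel-verified Lean document; each statement's English description precedes it below -/
import Mathlib

section
/- Let q > 2 be an odd prime power and c_0, c_1 ∈ F_q with c_0 ≠ 0, c_1 ≠ 0, 4·c_0 + 1 ≠ 0, c_0 + 4 ≠ 0, and c_0 ≠ −1. Let F : F_q → F_q be given by F(x) = ((c_0·x)^{q−2} + c_1)^{q−2} + x. Then the value set V_F = {F(c) : c ∈ F_q} has cardinality #V_F = (q + 2 − η(4·c_0 + 1) − η(c_0² + 4·c_0) + η(−c_0))/2. -/
open scoped Classical

/-- The quadratic character: `η(x) = 1` if `x` is a nonzero square, `-1` if `x` is a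
nonsquare, and `η(0) = 0`. -/
noncomputable def quadChar {K : Type*} [Field K] (x : K) : ℤ :=
  if x = 0 then 0 else if IsSquare x then 1 else -1

section

variable {K : Type*} [Field K] [Fintype K]

theorem quadChar_eq_quadraticChar (x : K) : quadChar x = quadraticChar K x := by
  rw [quadraticChar_apply]
  unfold quadChar quadraticCharFun
  congr

/-- The fibre of `w ↦ w - c / w` over `t` has `1 + η(t² + 4c)` elements. -/
theorem card_fiber_sub_div (hK : ringChar K ≠ 2) {c : K} (hc : c ≠ 0) (t : K) :
    ((Finset.univ.filter fun w : K => w ≠ 0 ∧ w - c / w = t).card : ℤ)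
      = quadraticChar K (t ^ 2 + 4 * c) + 1 := by
  have h2 : (2 : K) ≠ 0 := Ring.two_ne_zero hK
  rw [← quadraticChar_card_sqrts hK]
  norm_cast
  refine Finset.card_bij' (fun w _ => 2 * w - t) (fun v _ => (v + t) / 2) ?_ ?_ ?_ ?_
  · intro w hw
    obtain ⟨hw0, hw⟩ : w ≠ 0 ∧ w - c / w = t := by simpa using hw
    have : (2 * w - t) ^ 2 = t ^ 2 + 4 * c := by
      subst hw
      field_simp
      ring
    simpa using this
  · intro v hv
    have hv : v ^ 2 = t ^ 2 + 4 * c := by simpa using hv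
    have hc' : (v + t) / 2 * ((v + t) / 2 - t) = c := by
      field_simp
      linear_combination hv
    have hw0 : (v + t) / 2 ≠ 0 := by
      intro h
      rw [h, zero_mul] at hc'
      exact hc hc'.symm
    have : (v + t) / 2 - c / ((v + t) / 2) = t := by
      rw [sub_eq_iff_eq_add', ← sub_eq_iff_eq_add, eq_div_iff hw0]
      linear_combination hc'
    exact Finset.mem_filter.2 ⟨Finset.mem_univ _, hw0, this⟩
  · intro w _
    field_simp
    ring
  · intro v _
    field_simp
    ring

theorem sum_quadraticChar_sq_add (hK : ringChar K ≠ 2) {c : K} (hc : c ≠ 0) :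
    ∑ t : K, quadraticChar K (t ^ 2 + 4 * c) = -1 := by
  have h := Finset.card_eq_sum_card_fiberwise (s := Finset.univ.filter fun w : K => w ≠ 0)
    (t := Finset.univ) (f := fun w => w - c / w) (by simp)
  have h0 : (Finset.univ.filter fun w : K => w ≠ 0).card + 1 = Fintype.card K := by
    rw [Finset.filter_ne', Finset.card_erase_add_one (Finset.mem_univ _), Finset.card_univ]
  simp only [Finset.filter_filter] at h
  zify at h h0
  simp only [card_fiber_sub_div hK hc, Finset.sum_add_distrib] at h
  simp only [ne_eq, Finset.sum_const, Finset.card_univ, nsmul_eq_mul, mul_one] at h h0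
  linarith

/-- The image of the nonzero elements under `w ↦ w - c / w`. -/
noncomputable def subDivImage (c : K) : Finset K :=
  (Finset.univ.filter fun w : K => w ≠ 0).image fun w => w - c / w

theorem mem_subDivImage {c t : K} : t ∈ subDivImage c ↔ ∃ w : K, w ≠ 0 ∧ w - c / w = t := by
  simp [subDivImage]

theorem two_mul_ite_mem_subDivImage (hK : ringChar K ≠ 2) {c : K} (hc : c ≠ 0) (t : K) :
    2 * (if t ∈ subDivImage c then 1 else 0 : ℤ)
      = quadraticChar K (t ^ 2 + 4 * c) + 1 + if t ^ 2 = -4 * c then 1 else 0 := by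
  have hmem : t ∈ subDivImage c ↔ quadraticChar K (t ^ 2 + 4 * c) + 1 ≠ 0 := by
    rw [← card_fiber_sub_div hK hc, mem_subDivImage, Nat.cast_ne_zero, Finset.card_ne_zero]
    simp [Finset.Nonempty]
  by_cases hD : t ^ 2 + 4 * c = 0
  · have : t ^ 2 = -4 * c := by linear_combination hD
    rw [if_pos this, hD, quadraticChar_zero, if_pos (by rw [hmem, hD, quadraticChar_zero]; simp)]
    norm_num
  · have : t ^ 2 ≠ -4 * c := fun h => hD (by linear_combination h)
    rcases quadraticChar_dichotomy hD with h | h <;>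
      simp only [hmem, h, if_neg this] <;> norm_num

theorem two_mul_card_subDivImage (hK : ringChar K ≠ 2) {c : K} (hc : c ≠ 0) :
    2 * ((subDivImage c).card : ℤ) = Fintype.card K + quadraticChar K (-c) := by
  have h2 : (2 : K) ≠ 0 := Ring.two_ne_zero hK
  have hcard : ((subDivImage c).card : ℤ) = ∑ t : K, if t ∈ subDivImage c then 1 else 0 := by
    simp
  have hroots : (∑ t : K, if t ^ 2 = -4 * c then 1 else 0 : ℤ) = quadraticChar K (-c) + 1 := by
    have h := quadraticChar_card_sqrts hK (-4 * c)
    have h4 : quadraticChar K (-4 * c) = quadraticChar K (-c) := by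
      rw [show -4 * c = 2 ^ 2 * -c by ring, map_mul, quadraticChar_sq_one' h2, one_mul]
    rw [← h4, ← h, Finset.sum_boole]
    congr 2
    ext
    simp
  rw [hcard, Finset.mul_sum]
  simp only [two_mul_ite_mem_subDivImage hK hc, Finset.sum_add_distrib, hroots,
    sum_quadraticChar_sq_add hK hc]
  simp
  ring

theorem pow_card_sub_two {q : ℕ} (hq : 2 < q) (hcard : Fintype.card K = q) (x : K) :
    x ^ (q - 2) = x⁻¹ := by
  rcases eq_or_ne x 0 with rfl | hx
  · rw [inv_zero, zero_pow (by omega)]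
  · apply eq_inv_of_mul_eq_one_left
    rw [← pow_succ, show q - 2 + 1 = Fintype.card K - 1 by omega]
    exact FiniteField.pow_card_sub_one_eq_one x hx

theorem image_range_eq_insert_subDivImage {c d : K} (hc : c ≠ 0) (hd : d ≠ 0) (hne : c ≠ -1) :
    (fun y => c * d * y - c + 1) '' Set.range (fun x : K => ((c * x)⁻¹ + d)⁻¹ + x)
      = ↑(insert 1 (insert (-c) (subDivImage c))) := by
  have key : ∀ w : K, w ≠ 0 → w ≠ 1 →
      c * d * (((c * ((w - 1) / (c * d)))⁻¹ + d)⁻¹ + (w - 1) / (c * d)) - c + 1 = w - c / w := by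
    intro w h0 h1
    have h1' : w - 1 ≠ 0 := sub_ne_zero.2 h1
    have : (c * ((w - 1) / (c * d)))⁻¹ + d = d * w / (w - 1) := by
      field_simp
      ring
    rw [this]
    field_simp
    ring
  ext t
  simp only [Set.mem_image, Set.mem_range, exists_exists_eq_and, Finset.coe_insert,
    Set.mem_insert_iff, Finset.mem_coe, mem_subDivImage]
  constructor
  · rintro ⟨x, rfl⟩
    obtain ⟨w, rfl⟩ : ∃ w, x = (w - 1) / (c * d) := ⟨c * d * x + 1, by field_simp; ring⟩
    rcases eq_or_ne w 0 with rfl | h0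
    · right; left
      have : (c * ((0 - 1) / (c * d)))⁻¹ + d = 0 := by
        field_simp
        ring
      rw [this]
      field_simp
      ring
    rcases eq_or_ne w 1 with rfl | h1
    · left
      simp
      field_simp
      ring
    · exact Or.inr (Or.inr ⟨w, h0, (key w h0 h1).symm⟩)
  · rintro (rfl | rfl | ⟨w, h0, rfl⟩)
    · refine ⟨0, ?_⟩
      simp
      field_simp
      ring
    · refine ⟨(0 - 1) / (c * d), ?_⟩
      have : (c * ((0 - 1) / (c * d)))⁻¹ + d = 0 := by
        field_simp
        ring
      rw [this]
      field_simp
      ring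
    · rcases eq_or_ne w 1 with rfl | h1
      · refine ⟨(-c - 1) / (c * d), ?_⟩
        rw [key (-c) (neg_ne_zero.2 hc) fun h => hne (by linear_combination -h)]
        field_simp
        ring
      · exact ⟨_, key w h0 h1⟩

end

/-- For odd `q > 2` and `c₀, c₁ ≠ 0` with `4c₀ + 1 ≠ 0`, `c₀ + 4 ≠ 0`, `c₀ ≠ -1`, the
value set of `F(x) = ((c₀ x)^{q-2} + c₁)^{q-2} + x` over `F_q` has exactly
`(q + 2 - η(4c₀+1) - η(c₀² + 4c₀) + η(-c₀))/2` elements. -/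
theorem value_set_card_carlitz_rank_two
    (q : ℕ) (hq : 2 < q) (hodd : Odd q)
    (K : Type*) [Field K] [Fintype K] (hcard : Fintype.card K = q)
    (c₀ c₁ : K) (hc₀ : c₀ ≠ 0) (hc₁ : c₁ ≠ 0)
    (h4 : 4 * c₀ + 1 ≠ 0) (h4' : c₀ + 4 ≠ 0) (hne : c₀ ≠ -1) :
    (Set.ncard (Set.range (fun x : K => ((c₀ * x) ^ (q - 2) + c₁) ^ (q - 2) + x)) : ℤ)
      = ((q : ℤ) + 2 - quadChar (4 * c₀ + 1) - quadChar (c₀ ^ 2 + 4 * c₀)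
          + quadChar (-c₀)) / 2 := by
  have hK : ringChar K ≠ 2 := by
    intro h
    have := FiniteField.even_card_of_char_two h
    rw [hcard] at this
    exact absurd hodd (by rw [Nat.odd_iff]; omega)
  have hinj : Function.Injective fun y : K => c₀ * c₁ * y - c₀ + 1 := by
    intro y z h
    exact mul_left_cancel₀ (mul_ne_zero hc₀ hc₁) (by linear_combination h)
  have hA := two_mul_card_subDivImage hK hc₀
  have hone := two_mul_ite_mem_subDivImage hK hc₀ 1
  have hneg := two_mul_ite_mem_subDivImage hK hc₀ (-c₀)
  rw [if_neg (c := (1 : K) ^ 2 = -4 * c₀) fun h => h4 (by linear_combination h),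
    show (1 : K) ^ 2 + 4 * c₀ = 4 * c₀ + 1 by ring] at hone
  rw [if_neg (c := (-c₀) ^ 2 = -4 * c₀) fun h =>
      mul_ne_zero hc₀ h4' (by linear_combination h), neg_sq] at hneg
  have hne' : (1 : K) ≠ -c₀ := fun h => hne (by rw [h, neg_neg])
  simp only [pow_card_sub_two hq hcard, quadChar_eq_quadraticChar]
  rw [← Set.ncard_image_of_injective _ hinj, image_range_eq_insert_subDivImage hc₀ hc₁ hne,
    Set.ncard_coe_finset, Finset.card_insert_eq_ite, Finset.card_insert_eq_ite]
  simp only [Finset.mem_insert, or_iff_right hne']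
  rw [hcard] at hA
  split_ifs at hone hneg ⊢ <;> push_cast <;> omega
end

section
/- Let q be a power of 2 and α, β, γ, δ ∈ F_q with γ ≠ 0 and α·δ − β·γ ≠ 0. Then the image of the set {x ∈ F_q : γ·x + δ ≠ 0} under the map x ↦ (α·x + β)/(γ·x + δ) + x has at most q/2 elements. -/
/-- In a finite field where `2 = 0`, the map `u ↦ u + d / u` (with `d / 0 = 0`) takes each of its
values at least twice. -/
theorem two_mul_card_image_add_div_le {K : Type*} [Field K] [Fintype K] [DecidableEq K]
    (h2 : (2 : K) = 0) {d : K} (hd : d ≠ 0) :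
    2 * (Finset.univ.image fun u : K => u + d / u).card ≤ Fintype.card K := by
  have : CharP K 2 := CharTwo.of_one_ne_zero_of_two_eq_zero one_ne_zero h2
  obtain ⟨s, hs⟩ : IsSquare d := FiniteField.isSquare_of_char_two (ringChar.eq K 2) d
  have hs0 : s ≠ 0 := by
    rintro rfl
    simp [hd] at hs
  have hval : s + d / s = 0 + d / 0 := by
    rw [hs, mul_div_cancel_right₀ _ hs0, CharTwo.add_self_eq_zero]
    simp
  rw [← Finset.card_univ]
  refine Finset.mul_card_image_le_card Finset.univ 2 fun a ha => ?_
  obtain ⟨u, -, rfl⟩ := Finset.mem_image.1 ha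
  suffices h : ∃ v, u ≠ v ∧ v + d / v = u + d / u by
    obtain ⟨v, huv, hv⟩ := h
    rw [← Finset.card_pair huv]
    refine Finset.card_le_card ?_
    simp [Finset.insert_subset_iff, hv]
  by_cases hu : u = 0
  · exact ⟨s, by rw [hu]; exact hs0.symm, by rw [hu, hval]⟩
  by_cases hus : u = s
  · exact ⟨0, hu, by rw [hus, hval]⟩
  refine ⟨d / u, fun h => hus ?_, by rw [div_div_cancel₀ hd, add_comm]⟩
  rw [eq_div_iff hu, hs] at h
  exact CharTwo.sq_injective (by simpa only [sq] using h)

/-- For `q` a power of `2` and `α, β, γ, δ ∈ F_q` with `γ ≠ 0` and `αδ - βγ ≠ 0`, the image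
of `{x : γx + δ ≠ 0}` under `x ↦ (αx + β)/(γx + δ) + x` has at most `q/2` elements. -/
theorem image_card_fractional_linear_plus_x_char_two
    (q : ℕ) (hq2 : ∃ m : ℕ, q = 2 ^ m)
    (K : Type*) [Field K] [Fintype K] (hcard : Fintype.card K = q)
    (α β γ δ : K) (hγ : γ ≠ 0) (hdet : α * δ - β * γ ≠ 0) :
    Set.ncard ((fun x : K => (α * x + β) / (γ * x + δ) + x) ''
        {x : K | γ * x + δ ≠ 0}) ≤ q / 2 := by
  classical
  obtain ⟨m, rfl⟩ := hq2
  have h2 : (2 : K) = 0 := by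
    have h : ((Fintype.card K : ℕ) : K) = 0 := Nat.cast_card_eq_zero K
    rw [hcard, Nat.cast_pow, Nat.cast_ofNat] at h
    exact eq_zero_of_pow_eq_zero h
  set d := β * γ - α * δ with hd
  have hd0 : d ≠ 0 := fun h => hdet (by linear_combination -h)
  have hsub : ((fun x : K => (α * x + β) / (γ * x + δ) + x) '' {x : K | γ * x + δ ≠ 0}) ⊆
      ((Finset.univ.image fun u : K => u + d / u).image fun v => (α - δ + v) / γ : Finset K) := by
    rintro _ ⟨x, hx, rfl⟩
    have hx : γ * x + δ ≠ 0 := hx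
    rw [Finset.mem_coe, Finset.image_image]
    refine Finset.mem_image.2 ⟨γ * x + δ, Finset.mem_univ _, ?_⟩
    simp only [Function.comp_apply, hd]
    field_simp
    ring
  have hle := Set.ncard_le_ncard hsub (Finset.finite_toSet _)
  rw [Set.ncard_coe_finset] at hle
  have hbound := two_mul_card_image_add_div_le h2 hd0
  rw [hcard] at hbound
  have := hle.trans Finset.card_image_le
  omega
end
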